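/- arXiv:2108.06350 — 4 statements merged into one kernel-verified Lean document; each statement's English description precedes it below -/
import Mathlib

section
/- For every ideal I of R = k[x_1,…,x_n] and every s ∈ ℕ, the ideal of J_s(R) generated by the jet coefficients f_{i,j} (1 ≤ i ≤ r, 0 ≤ j ≤ s) of any finite generating set f_1,…,f_r of I equals the ideal generated by the jet coefficients f_j of all elements f ∈ I (0 ≤ j ≤ s). In particular, the ideal of s-jets J_s(I) does not depend on the choice of generators of I. -/
open MvPolynomial

/-- The substitution `xᵢ ↦ Σ_{j=0}^s x_{i,j} tʲ` taking a polynomial in the variables `σ`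
to a polynomial in `t` with coefficients in the jet polynomial ring `k[x_{i,j}]`. -/
noncomputable def jetSub (k : Type*) [Field k] {σ : Type*} (s : ℕ) :
    MvPolynomial σ k →ₐ[k] Polynomial (MvPolynomial (σ × Fin (s + 1)) k) :=
  MvPolynomial.aeval fun i =>
    ∑ j : Fin (s + 1), Polynomial.C (MvPolynomial.X (i, j)) * Polynomial.X ^ (j : ℕ)

/-- The `j`-th jet coefficient `f_j` of `f`. -/
noncomputable def jetCoeff (k : Type*) [Field k] {σ : Type*} (s : ℕ)
    (f : MvPolynomial σ k) (j : ℕ) : MvPolynomial (σ × Fin (s + 1)) k :=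
  (jetSub k s f).coeff j

/-- The ideal of `s`-jets generated by the jet coefficients of a set of generators `F`. -/
noncomputable def jetIdeal (k : Type*) [Field k] {σ : Type*} (s : ℕ)
    (F : Set (MvPolynomial σ k)) : Ideal (MvPolynomial (σ × Fin (s + 1)) k) :=
  Ideal.span {g | ∃ f ∈ F, ∃ j ≤ s, g = jetCoeff k s f j}

theorem jetIdeal_mono (k : Type*) [Field k] {σ : Type*} (s : ℕ)
    {F G : Set (MvPolynomial σ k)} (h : F ⊆ G) : jetIdeal k s F ≤ jetIdeal k s G :=
  Ideal.span_mono fun _ ⟨f, hf, j, hj, hg⟩ => ⟨f, h hf, j, hj, hg⟩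

theorem jetCoeff_mem_jetIdeal_of_mem_span (k : Type*) [Field k] {σ : Type*} (s : ℕ)
    {F : Set (MvPolynomial σ k)} {f : MvPolynomial σ k} (hf : f ∈ Ideal.span F) :
    ∀ j ≤ s, jetCoeff k s f j ∈ jetIdeal k s F := by
  induction hf using Submodule.span_induction with
  | mem f hf => exact fun j hj => Ideal.subset_span ⟨f, hf, j, hj, rfl⟩
  | zero => simp [jetCoeff]
  | add f g _ _ hf hg =>
    intro j hj
    simpa [jetCoeff] using add_mem (hf j hj) (hg j hj)
  | smul a f _ hf =>
    intro j hj
    rw [jetCoeff, smul_eq_mul, map_mul, Polynomial.coeff_mul]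
    exact sum_mem fun p hp => Ideal.mul_mem_left _ _
      (hf p.2 ((Finset.HasAntidiagonal.antidiagonal.snd_le hp).trans hj))

/-- The ideal of `s`-jets of a set depends only on the ideal generated by that set. -/
theorem jetIdeal_span (k : Type*) [Field k] {σ : Type*} (s : ℕ)
    (F : Set (MvPolynomial σ k)) :
    jetIdeal k s (Ideal.span F : Set (MvPolynomial σ k)) = jetIdeal k s F := by
  refine le_antisymm (Ideal.span_le.2 ?_) (jetIdeal_mono k s Ideal.subset_span)
  rintro _ ⟨f, hf, j, hj, rfl⟩
  exact jetCoeff_mem_jetIdeal_of_mem_span k s hf j hj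

/-- the ideal of `s`-jets generated by the jet coefficients of any finite
generating set of `I` equals the ideal generated by the jet coefficients of all elements
of `I`; in particular `J_s(I)` does not depend on the choice of generators. -/
theorem jetIdeal_independent_of_generators (k : Type*) [Field k] (n r : ℕ) (hn : 1 ≤ n)
    (s : ℕ) (f : Fin r → MvPolynomial (Fin n) k)
    (I : Ideal (MvPolynomial (Fin n) k)) (hI : I = Ideal.span (Set.range f)) :
    jetIdeal k s (Set.range f) = jetIdeal k s (I : Set (MvPolynomial (Fin n) k)) := by
  rw [hI, jetIdeal_span]
end

section
/- Assume char k = 0. If I is an ideal of R = k[x_1,…,x_n] generated by monomials, then for every s ∈ ℕ the radical of the ideal of s-jets J_s(I) is a squarefree monomial ideal, i.e., rad(J_s(I)) is generated by squarefree monomials in the variables x_{i,j}. -/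
open MvPolynomial

/-- An ideal generated by variables is prime. -/
lemma isPrime_span_X_image {R τ : Type*} [CommRing R] [IsDomain R] (T : Set τ) :
    (Ideal.span (X '' T : Set (MvPolynomial τ R))).IsPrime := by
  classical
  let φ : MvPolynomial τ R →ₐ[R] MvPolynomial τ R := aeval fun i => if i ∈ T then 0 else X i
  let π := Ideal.Quotient.mkₐ R (Ideal.span (X '' T : Set (MvPolynomial τ R)))
  have hπ : π.comp φ = π := by
    ext i
    by_cases hi : i ∈ T
    · have : π (X i) = 0 := Ideal.Quotient.eq_zero_iff_mem.2 (Ideal.subset_span ⟨i, hi, rfl⟩)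
      simp [φ, hi, this]
    · simp [φ, hi]
  have hker : Ideal.span (X '' T : Set (MvPolynomial τ R)) = RingHom.ker φ := by
    refine le_antisymm (Ideal.span_le.2 ?_) fun f hf => ?_
    · rintro _ ⟨i, hi, rfl⟩
      simp [φ, hi]
    · have hf' := DFunLike.congr_fun hπ f
      rw [AlgHom.comp_apply, (RingHom.mem_ker).1 hf, map_zero] at hf'
      exact Ideal.Quotient.eq_zero_iff_mem.1 hf'.symm
  rw [hker]
  exact RingHom.ker_isPrime _

section JetRadical

variable (k : Type*) [Field k] {σ : Type*} (s : ℕ)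

/-- The ideal of jets whose `i`-th coordinate has order at least `v i`. -/
noncomputable def jetOrderIdeal (v : σ → ℕ) : Ideal (MvPolynomial (σ × Fin (s + 1)) k) :=
  Ideal.span (X '' {p | (p.2 : ℕ) < v p.1})

/-- `v` is an admissible vector of orders for `G` if every monomial with exponent in `G`
vanishes to order greater than `s` along jets of order `v`. -/
def IsJetOrder (G : Set (σ →₀ ℕ)) (v : σ → ℕ) : Prop :=
  ∀ d ∈ G, s < d.sum fun i e => v i * e

variable {k s}

lemma mem_jetOrderIdeal_iff {v : σ → ℕ} {f : MvPolynomial (σ × Fin (s + 1)) k} :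
    f ∈ jetOrderIdeal k s v ↔ ∀ m ∈ f.support, ∃ p, (p.2 : ℕ) < v p.1 ∧ m p ≠ 0 := by
  simp [jetOrderIdeal, mem_ideal_span_X_image]

lemma exists_map_jetSub_X_eq {A : Type*} [CommRing A]
    (φ : MvPolynomial (σ × Fin (s + 1)) k →+* A) {v : σ → ℕ} {i : σ}
    (h : ∀ j : Fin (s + 1), (j : ℕ) < v i → φ (X (i, j)) = 0) :
    ∃ q, (jetSub k s (X i)).map φ = Polynomial.X ^ v i * q := by
  change Polynomial.X ^ v i ∣ (jetSub k s (X i)).map φ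
  simp only [jetSub, aeval_X, Polynomial.map_sum, Polynomial.map_mul, Polynomial.map_C,
    Polynomial.map_pow, Polynomial.map_X]
  refine Finset.dvd_sum fun j _ => ?_
  by_cases hj : (j : ℕ) < v i
  · simp [h j hj]
  · exact (pow_dvd_pow _ (not_lt.1 hj)).mul_left _

lemma coeff_jetSub_X (i : σ) (j : Fin (s + 1)) :
    (jetSub k s (X i)).coeff j = X (i, j) := by
  simp [jetSub, Polynomial.finsetSum_coeff, Polynomial.coeff_C_mul, Polynomial.coeff_X_pow,
    Fin.val_inj]

lemma map_jetSub_monomial {A : Type*} [CommRing A] (φ : MvPolynomial (σ × Fin (s + 1)) k →+* A)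
    {v : σ → ℕ} {q : σ → Polynomial A}
    (hq : ∀ i, (jetSub k s (X i)).map φ = Polynomial.X ^ v i * q i) (d : σ →₀ ℕ) :
    (jetSub k s (monomial d 1)).map φ =
      Polynomial.X ^ (d.sum fun i e => v i * e) * d.prod fun i e => q i ^ e := by
  have hd : (monomial d (1 : k)) = d.prod fun i e => X i ^ e := by
    rw [monomial_eq]; simp
  rw [hd, Finsupp.prod, map_prod, Polynomial.map_prod, Finsupp.sum, ← Finset.prod_pow_eq_pow_sum,
    Finsupp.prod, ← Finset.prod_mul_distrib]
  refine Finset.prod_congr rfl fun i _ => ?_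
  rw [map_pow, Polynomial.map_pow, hq, mul_pow, pow_mul]

lemma jetIdeal_le_iff {G : Set (σ →₀ ℕ)} {I : Ideal (MvPolynomial (σ × Fin (s + 1)) k)} :
    jetIdeal k s ((fun d => monomial d (1 : k)) '' G) ≤ I ↔
      ∀ d ∈ G, ∀ j ≤ s,
        ((jetSub k s (monomial d 1)).map (Ideal.Quotient.mk I)).coeff j = 0 := by
  rw [jetIdeal, Ideal.span_le]
  simp only [Polynomial.coeff_map, Ideal.Quotient.eq_zero_iff_mem]
  constructor
  · exact fun h d hd j hj => h ⟨_, ⟨d, hd, rfl⟩, j, hj, rfl⟩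
  · rintro h _ ⟨_, ⟨d, hd, rfl⟩, j, hj, rfl⟩
    exact h d hd j hj

lemma jetIdeal_le_jetOrderIdeal {G : Set (σ →₀ ℕ)} {v : σ → ℕ} (hv : IsJetOrder s G v) :
    jetIdeal k s ((fun d => monomial d (1 : k)) '' G) ≤ jetOrderIdeal k s v := by
  have hX (i : σ) := exists_map_jetSub_X_eq (Ideal.Quotient.mk (jetOrderIdeal k s v))
    (i := i) fun j hj =>
      Ideal.Quotient.eq_zero_iff_mem.2 (Ideal.subset_span ⟨(i, j), hj, rfl⟩)
  choose q hq using hX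
  refine jetIdeal_le_iff.2 fun d hd j hj => ?_
  rw [map_jetSub_monomial _ hq, Polynomial.coeff_X_pow_mul', if_neg]
  exact not_le.2 (hj.trans_lt (hv d hd))

lemma exists_isJetOrder_of_isPrime {G : Set (σ →₀ ℕ)}
    {P : Ideal (MvPolynomial (σ × Fin (s + 1)) k)} [hP : P.IsPrime]
    (h : jetIdeal k s ((fun d => monomial d (1 : k)) '' G) ≤ P) :
    ∃ v, IsJetOrder s G v ∧ jetOrderIdeal k s v ≤ P := by
  classical
  have hex (i : σ) : ∃ j, ∀ hj : j < s + 1, X (i, ⟨j, hj⟩) ∉ P :=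
    ⟨s + 1, fun hj => absurd hj (lt_irrefl _)⟩
  let v (i : σ) : ℕ := Nat.find (hex i)
  have hlt (i : σ) (j : Fin (s + 1)) (hj : (j : ℕ) < v i) : X (i, j) ∈ P := by
    have := Nat.find_min (hex i) hj
    push Not at this
    exact this.2
  refine ⟨v, fun d hd => ?_, Ideal.span_le.2 ?_⟩
  · by_contra! hs
    choose q hq using fun i => exists_map_jetSub_X_eq (Ideal.Quotient.mk P)
      fun j hj => Ideal.Quotient.eq_zero_iff_mem.2 (hlt i j hj)
    have h0 := jetIdeal_le_iff.1 h d hd _ hs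
    rw [map_jetSub_monomial _ hq, Polynomial.coeff_X_pow_mul', if_pos le_rfl, Nat.sub_self,
      Polynomial.coeff_zero_eq_eval_zero, Finsupp.prod, Polynomial.eval_prod] at h0
    obtain ⟨i, hi, hi0⟩ := Finset.prod_eq_zero_iff.1 h0
    have hvi : v i < s + 1 := by
      refine Nat.lt_succ_of_le (le_trans ?_ hs)
      refine (Nat.le_mul_of_pos_right _ (Nat.pos_of_ne_zero (Finsupp.mem_support_iff.1 hi))).trans ?_
      exact Finset.single_le_sum (f := fun i => v i * d i) (fun _ _ => Nat.zero_le _) hi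
    rw [Polynomial.eval_pow, ← Polynomial.coeff_zero_eq_eval_zero] at hi0
    have hc := congrArg (Polynomial.coeff · (v i)) (hq i)
    simp only [Polynomial.coeff_X_pow_mul', le_refl, if_true, Nat.sub_self, Polynomial.coeff_map,
      eq_zero_of_pow_eq_zero hi0] at hc
    rw [coeff_jetSub_X i ⟨v i, hvi⟩, Ideal.Quotient.eq_zero_iff_mem] at hc
    exact Nat.find_spec (hex i) hvi hc
  · rintro _ ⟨⟨i, j⟩, hj, rfl⟩
    exact hlt i j hj

lemma mem_radical_jetIdeal_iff {G : Set (σ →₀ ℕ)} {f : MvPolynomial (σ × Fin (s + 1)) k} :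
    f ∈ (jetIdeal k s ((fun d => monomial d (1 : k)) '' G)).radical ↔
      ∀ v, IsJetOrder s G v → f ∈ jetOrderIdeal k s v := by
  constructor
  · intro hf v hv
    have hP : (jetOrderIdeal k s v).IsPrime := isPrime_span_X_image _
    exact hP.radical_le_iff.2 (jetIdeal_le_jetOrderIdeal hv) hf
  · intro hf
    rw [Ideal.radical_eq_sInf, Ideal.mem_sInf]
    rintro P ⟨hJ, hP⟩
    obtain ⟨v, hv, hle⟩ := exists_isJetOrder_of_isPrime hJ
    exact hle (hf v hv)

end JetRadical

/-- in characteristic zero, if `I` is an ideal of `R` generated by monomials,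
then for every `s` the radical of the ideal of `s`-jets of `I` is a squarefree monomial
ideal, i.e. it is generated by monomials in which every variable occurs with exponent at
most `1`. -/
theorem radical_jets_of_monomialIdeal_is_squarefree_monomial (k : Type*) [Field k]
    [CharZero k] (n s : ℕ) (hn : 1 ≤ n) (G : Set (Fin n →₀ ℕ)) :
    ∃ G' : Set (Fin n × Fin (s + 1) →₀ ℕ),
      (∀ d ∈ G', ∀ v, d v ≤ 1) ∧
        (jetIdeal k s ((fun d => MvPolynomial.monomial d (1 : k)) '' G)).radical =
          Ideal.span ((fun d => MvPolynomial.monomial d (1 : k)) '' G') := by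
  refine ⟨{d | (∀ p, d p ≤ 1) ∧
    ∀ v, IsJetOrder s G v → ∃ p, (p.2 : ℕ) < v p.1 ∧ d p ≠ 0}, fun d hd => hd.1, ?_⟩
  ext f
  simp only [mem_radical_jetIdeal_iff, mem_jetOrderIdeal_iff, mem_ideal_span_monomial_image]
  constructor
  · intro h m hm
    refine ⟨m.mapRange (min 1) (by simp), ⟨fun p => by simp, fun v hv => ?_⟩, fun p => by simp⟩
    obtain ⟨p, hp, hmp⟩ := h v hv m hm
    exact ⟨p, hp, by rw [Finsupp.mapRange_apply]; omega⟩
  · intro h v hv m hm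
    obtain ⟨d, hd, hdm⟩ := h m hm
    obtain ⟨p, hp, hdp⟩ := hd.2 v hv
    exact ⟨p, hp, (Nat.pos_of_ne_zero hdp |>.trans_le (hdm p)).ne'⟩
end

section
/- Let k be an algebraically closed field of characteristic zero, let n ≥ 1, and let R = k[x_{a,b} : 1 ≤ a,b ≤ n]. Let f = det(X) be the determinant of the generic n×n matrix X = (x_{a,b}) and I = ⟨f⟩. Then for every s ∈ ℕ, the radical of the ideal of s-jets J_s(I) is a prime ideal; that is, the s-jet scheme of the determinantal hypersurface {det = 0} is irreducible. -/
open MvPolynomial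

section Triangularization

variable {O : Type*} [CommRing O] [IsDomain O] [ValuationRing O]

theorem ValuationRing.exists_forall_dvd {ι : Type*} [Finite ι] [Nonempty ι] (f : ι → O) :
    ∃ i₀, ∀ i, f i₀ ∣ f i := by
  have hdir : Directed (fun a b : O => b ∣ a) f := fun i j =>
    (ValuationRing.dvd_total (f i) (f j)).elim (fun h => ⟨i, dvd_rfl, h⟩)
      fun h => ⟨j, h, dvd_rfl⟩
  have : IsTrans O (fun a b : O => b ∣ a) := ⟨fun _ _ _ h₁ h₂ => h₂.trans h₁⟩
  exact hdir.finite_le id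

/-- Over a valuation ring every square matrix can be made upper triangular by invertible row
operations. -/
theorem Matrix.exists_isUnit_det_mul_isUpperTriangular (n : ℕ) (A : Matrix (Fin n) (Fin n) O) :
    ∃ Q : Matrix (Fin n) (Fin n) O, IsUnit Q.det ∧ (Q * A).IsUpperTriangular := by
  induction n with
  | zero => exact ⟨1, by simp, fun i => i.elim0⟩
  | succ n ih =>
    obtain ⟨i₀, hi₀⟩ := ValuationRing.exists_forall_dvd fun i => A i 0
    choose c hc using fun j => hi₀ (i₀.succAbove j)
    obtain ⟨Q', hQ', hT⟩ :=
      ih (Matrix.of fun j l => A (i₀.succAbove j) l.succ - c j * A i₀ l.succ)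
    let Q : Matrix (Fin (n + 1)) (Fin (n + 1)) O :=
      Matrix.of (Fin.cons (Pi.single i₀ 1)
        fun i => i₀.insertNth (-∑ j, Q' i j * c j) (Q' i))
    have hsub : Q.submatrix Fin.succ i₀.succAbove = Q' := by
      ext i j
      simp [Q]
    have hmul (i : Fin n) (l : Fin (n + 1)) :
        (Q * A) i.succ l = ∑ j, Q' i j * (A (i₀.succAbove j) l - c j * A i₀ l) := by
      simp only [Matrix.mul_apply, Fin.sum_univ_succAbove _ i₀, Q, Matrix.of_apply,
        Fin.cons_succ, Fin.insertNth_apply_same, Fin.insertNth_apply_succAbove, mul_sub,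
        Finset.sum_sub_distrib, neg_mul, Finset.sum_mul, mul_assoc]
      ring
    refine ⟨Q, ?_, ?_⟩
    · rw [Matrix.det_succ_row_zero, Finset.sum_eq_single i₀]
      · rw [hsub]
        simpa [Q] using (isUnit_one.neg.pow (i₀ : ℕ)).mul hQ'
      · intro j _ hj
        simp [Q, hj]
      · simp
    · intro i l hil
      simp only [id] at hil
      induction i using Fin.cases with
      | zero => exact absurd hil (Fin.not_lt_zero l)
      | succ i =>
        rw [hmul]
        induction l using Fin.cases with
        | zero =>
          refine Finset.sum_eq_zero fun j _ => ?_
          rw [hc j]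
          ring
        | succ l =>
          have := hT (i := i) (j := l) (Fin.succ_lt_succ_iff.mp hil)
          simpa [Matrix.mul_apply] using this

end Triangularization

/-- A matrix with an invertible maximal proper minor factors through rank `m` up to a multiple
of its determinant. -/
theorem Matrix.exists_dvd_sub_mul_of_isUnit_det_submatrix {O : Type*} [CommRing O] {m : ℕ}
    (D : Matrix (Fin (m + 1)) (Fin (m + 1)) O)
    (hM : IsUnit (D.submatrix Fin.castSucc Fin.succ).det) :
    ∃ (B : Matrix (Fin (m + 1)) (Fin m) O) (C : Matrix (Fin m) (Fin (m + 1)) O),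
      ∀ i j, D.det ∣ D i j - (B * C) i j := by
  set M := D.submatrix Fin.castSucc Fin.succ with hMdef
  let y : Fin m → O := M⁻¹.mulVec fun i => D i.castSucc 0
  have hy : M.mulVec y = fun i => D i.castSucc 0 := by
    simp [y, Matrix.mulVec_mulVec, Matrix.mul_nonsing_inv _ hM]
  let v : Fin (m + 1) → O := Fin.cons 1 fun l => -y l
  let e : O := D (Fin.last m) 0 - ∑ l : Fin m, D (Fin.last m) l.succ * y l
  have hv : D.mulVec v = Pi.single (Fin.last m) e := by
    ext i
    induction i using Fin.lastCases with
    | last => simp [Matrix.mulVec, dotProduct, Fin.sum_univ_succ, v, e, sub_eq_add_neg]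
    | cast i =>
      have := congrFun hy i
      simp only [Matrix.mulVec, dotProduct, hMdef, Matrix.submatrix_apply] at this
      simp [Matrix.mulVec, dotProduct, Fin.sum_univ_succ, v, this, Fin.castSucc_ne_last]
  have hdet : D.det = D.adjugate 0 (Fin.last m) * e := by
    have h := congrArg (fun w => D.adjugate.mulVec w 0) hv
    simpa [Matrix.mulVec_mulVec, Matrix.adjugate_mul, Matrix.smul_mulVec, v] using h
  have hunit : IsUnit (D.adjugate 0 (Fin.last m)) := by
    rw [Matrix.adjugate_fin_succ_eq_det_submatrix, Fin.succAbove_last]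
    have : (Fin.succAbove (0 : Fin (m + 1))) = Fin.succ := Fin.succAbove_zero
    rw [this]
    exact (isUnit_one.neg.pow _).mul hM
  refine ⟨D.submatrix id Fin.succ,
    Matrix.of fun l => Fin.cons (y l) fun j => if l = j then 1 else 0, fun i j => ?_⟩
  induction j using Fin.cases with
  | succ j => simp [Matrix.mul_apply]
  | zero =>
    induction i using Fin.lastCases with
    | last =>
      have : D.det ∣ e := by
        rw [hdet]
        exact (hunit.mul_left_dvd).mpr dvd_rfl
      simpa [Matrix.mul_apply, e] using this
    | cast i =>
      have := congrFun hy i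
      simp only [Matrix.mulVec, dotProduct, hMdef, Matrix.submatrix_apply] at this
      simp [Matrix.mul_apply, this]

/-- Every square matrix over `k⟦X⟧` lies on a line of matrices whose general member factors
through rank `m`, up to a multiple of the determinant. -/
theorem Matrix.exists_line_factoring_mod_det {k : Type*} [Field k] {m : ℕ}
    (A : Matrix (Fin (m + 1)) (Fin (m + 1)) (PowerSeries k)) :
    ∃ (N : Matrix (Fin (m + 1)) (Fin (m + 1)) (PowerSeries k)) (q : Polynomial k), q ≠ 0 ∧
      ∀ u : k, q.eval u ≠ 0 →
        ∃ (B : Matrix (Fin (m + 1)) (Fin m) (PowerSeries k))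
          (C : Matrix (Fin m) (Fin (m + 1)) (PowerSeries k)),
          ∀ i j, A.det ∣ (A + u • N) i j - (B * C) i j := by
  obtain ⟨Q, hQ, hT⟩ := A.exists_isUnit_det_mul_isUpperTriangular
  set T := Q * A with hTdef
  let S : Matrix (Fin (m + 1)) (Fin (m + 1)) (PowerSeries k) :=
    Matrix.of fun i j => if (i : ℕ) + 1 = j then 1 else 0
  let M₀ : Matrix (Fin m) (Fin m) k :=
    (T.submatrix Fin.castSucc Fin.succ).map PowerSeries.constantCoeff
  refine ⟨Q⁻¹ * S, (-M₀).charpoly, (Matrix.charpoly_monic _).ne_zero, fun u hu => ?_⟩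
  have htri : (T + u • S).IsUpperTriangular := fun i j hij => by
    have h0 := hT hij
    have : ¬ ((i : ℕ) + 1 = j) := by
      have : (j : ℕ) < i := hij
      omega
    simp [h0, S, this]
  have hdet : (T + u • S).det = T.det := by
    rw [Matrix.det_of_isUpperTriangular htri, Matrix.det_of_isUpperTriangular hT]
    simp [S]
  have hunit : IsUnit ((T + u • S).submatrix Fin.castSucc Fin.succ).det := by
    rw [PowerSeries.isUnit_iff_constantCoeff, RingHom.map_det, isUnit_iff_ne_zero]
    rw [Matrix.eval_charpoly] at hu
    convert hu using 2
    ext i j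
    by_cases h : i = j
    · simp [S, M₀, Matrix.scalar_apply, h, add_comm]
    · simp [S, M₀, Matrix.scalar_apply, h, Fin.val_ne_of_ne h]
  obtain ⟨B, C, hBC⟩ := (T + u • S).exists_dvd_sub_mul_of_isUnit_det_submatrix hunit
  refine ⟨Q⁻¹ * B, C, fun i j => ?_⟩
  have hA : A + u • (Q⁻¹ * S) = Q⁻¹ * (T + u • S) := by
    rw [Matrix.mul_add, hTdef, ← Matrix.mul_assoc, Matrix.nonsing_inv_mul _ hQ, Matrix.one_mul,
      Matrix.mul_smul]
  rw [hA, Matrix.mul_assoc, ← Matrix.sub_apply, ← Matrix.mul_sub, Matrix.mul_apply]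
  refine Finset.dvd_sum fun l _ => Dvd.dvd.mul_left ?_ _
  refine dvd_trans ?_ (hBC l j)
  rw [hdet, hTdef, Matrix.det_mul]
  exact dvd_mul_left _ _

/-- Jet coefficients compute the coefficients of `f` evaluated at power series. -/
theorem aeval_jetCoeff {k : Type*} [Field k] {σ S : Type*} [CommRing S] [Algebra k S] (s : ℕ)
    (y : σ → PowerSeries S) (f : MvPolynomial σ k) (j : ℕ) (hj : j ≤ s) :
    aeval (fun p : σ × Fin (s + 1) => PowerSeries.coeff (p.2 : ℕ) (y p.1)) (jetCoeff k s f j) =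
      PowerSeries.coeff j (aeval y f) := by
  induction f using MvPolynomial.induction_on generalizing j with
  | C a =>
    simp only [jetCoeff, algHom_C]
    rw [IsScalarTower.algebraMap_apply k (MvPolynomial (σ × Fin (s + 1)) k) (Polynomial _),
      Polynomial.algebraMap_apply, PowerSeries.algebraMap_apply, PowerSeries.coeff_C,
      Algebra.algebraMap_self, RingHom.id_apply, Polynomial.coeff_C]
    split_ifs <;> simp
  | add p q hp hq =>
    have := hp j hj
    have := hq j hj
    simp_all [jetCoeff]
  | mul_X p i hp =>
    simp only [jetCoeff, map_mul, Polynomial.coeff_mul, map_sum, PowerSeries.coeff_mul]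
    refine Finset.sum_congr rfl fun x hx => ?_
    have hx' := Finset.HasAntidiagonal.mem_antidiagonal.mp hx
    have h1 := hp x.1 (by omega)
    rw [jetCoeff] at h1
    rw [h1]
    congr 1
    have hlt : x.2 < s + 1 := by omega
    simp only [jetSub, aeval_X, Polynomial.finsetSum_coeff, Polynomial.coeff_C_mul,
      Polynomial.coeff_X_pow]
    rw [Finset.sum_eq_single ⟨x.2, hlt⟩]
    · simp
    · intro b _ hb
      have : x.2 ≠ b := fun h => hb (Fin.ext h.symm)
      simp [this]
    · simp

section Parametrization

variable (k : Type*) [Field k] (m s : ℕ)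

/-- The coordinate ring of pairs of arcs of `(m + 1) × m` and `m × (m + 1)` matrices. -/
abbrev FactorRing : Type _ :=
  MvPolynomial (((Fin (m + 1) × Fin m) ⊕ (Fin m × Fin (m + 1))) × ℕ) k

/-- The product of the generic arcs of `(m + 1) × m` and `m × (m + 1)` matrices. -/
noncomputable def genericProduct :
    Matrix (Fin (m + 1)) (Fin (m + 1)) (PowerSeries (FactorRing k m)) :=
  (Matrix.of fun i l => PowerSeries.mk fun j => (X (Sum.inl (i, l), j) : FactorRing k m)) *
    (Matrix.of fun l i => PowerSeries.mk fun j => (X (Sum.inr (l, i), j) : FactorRing k m))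

/-- The comorphism of the map sending a pair of arcs to the `s`-jet of their product. -/
noncomputable def productJet :
    MvPolynomial ((Fin (m + 1) × Fin (m + 1)) × Fin (s + 1)) k →ₐ[k] FactorRing k m :=
  aeval fun p => PowerSeries.coeff (p.2 : ℕ) (genericProduct k m p.1.1 p.1.2)

variable {k m s}

theorem det_genericProduct : (genericProduct k m).det = 0 := by
  by_contra h
  have hle := (Matrix.rank_of_det_ne_zero h).ge.trans
    ((Matrix.rank_mul_le_left _ _).trans (Matrix.rank_le_width _))
  simp at hle

theorem aeval_coeff_mul_eq_zero_of_mem_ker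
    {g : MvPolynomial ((Fin (m + 1) × Fin (m + 1)) × Fin (s + 1)) k}
    (hg : productJet k m s g = 0) (B : Matrix (Fin (m + 1)) (Fin m) (PowerSeries k))
    (C : Matrix (Fin m) (Fin (m + 1)) (PowerSeries k)) :
    aeval (fun p : (Fin (m + 1) × Fin (m + 1)) × Fin (s + 1) =>
      PowerSeries.coeff (p.2 : ℕ) ((B * C) p.1.1 p.1.2)) g = 0 := by
  let ψ : FactorRing k m →ₐ[k] k := aeval fun p =>
    PowerSeries.coeff p.2 (p.1.elim (fun q => B q.1 q.2) fun q => C q.1 q.2)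
  have hψ : ψ (productJet k m s g) = 0 := by rw [hg, map_zero]
  rw [productJet, ← AlgHom.comp_apply, comp_aeval] at hψ
  convert hψ using 3
  ext p
  simp [genericProduct, Matrix.mul_apply, PowerSeries.coeff_mul, ψ]

end Parametrization

theorem aeval_det_of_X {k S ι : Type*} [Field k] [CommRing S] [Algebra k S] [Fintype ι]
    [DecidableEq ι] (A : Matrix ι ι S) :
    aeval (fun p : ι × ι => A p.1 p.2)
      (Matrix.det (Matrix.of fun a b : ι => (X (a, b) : MvPolynomial (ι × ι) k))) = A.det := by
  rw [AlgHom.map_det]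
  congr 1
  ext a b
  simp

theorem jetIdeal_det_radical_eq_ker (k : Type*) [Field k] [IsAlgClosed k] (m s : ℕ) :
    (jetIdeal k s {Matrix.det (Matrix.of fun a b : Fin (m + 1) =>
      (X (a, b) : MvPolynomial (Fin (m + 1) × Fin (m + 1)) k))}).radical =
    RingHom.ker (productJet k m s) := by
  apply le_antisymm
  · have hprime : (RingHom.ker (productJet k m s)).IsPrime := RingHom.ker_isPrime _
    rw [hprime.radical_le_iff, jetIdeal, Ideal.span_le]
    rintro _ ⟨_, rfl, j, hj, rfl⟩
    rw [SetLike.mem_coe, RingHom.mem_ker, productJet,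
      aeval_jetCoeff s (fun p : Fin (m + 1) × Fin (m + 1) => genericProduct k m p.1 p.2) _ j hj, aeval_det_of_X,
      det_genericProduct, map_zero]
  · rw [← vanishingIdeal_zeroLocus_eq_radical (K := k)]
    intro g hg p hp
    let A : Matrix (Fin (m + 1)) (Fin (m + 1)) (PowerSeries k) := Matrix.of fun a b =>
      PowerSeries.mk fun j => if h : j < s + 1 then p ((a, b), ⟨j, h⟩) else 0
    have hA (a b) (j : Fin (s + 1)) : PowerSeries.coeff (j : ℕ) (A a b) = p ((a, b), j) := by
      simp [A, -Order.lt_add_one_iff]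
    have hpA : p = fun q => PowerSeries.coeff (q.2 : ℕ) (A q.1.1 q.1.2) := by
      ext q
      rw [hA]
    have hdet : (PowerSeries.X : PowerSeries k) ^ (s + 1) ∣ A.det := by
      rw [PowerSeries.X_pow_dvd_iff]
      intro j hj
      rw [← aeval_det_of_X (k := k), ← aeval_jetCoeff s _ _ j (Nat.lt_succ_iff.mp hj)]
      have := hp _ (Ideal.subset_span ⟨_, rfl, j, Nat.lt_succ_iff.mp hj, rfl⟩)
      rwa [hpA] at this
    obtain ⟨N, q, hq, hfac⟩ := A.exists_line_factoring_mod_det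
    let h : Polynomial k := aeval (fun r : (Fin (m + 1) × Fin (m + 1)) × Fin (s + 1) =>
      Polynomial.C (p r) +
        Polynomial.X * Polynomial.C (PowerSeries.coeff (r.2 : ℕ) (N r.1.1 r.1.2))) g
    have heval (u : k) : h.eval u =
        aeval (fun r => p r + u * PowerSeries.coeff (r.2 : ℕ) (N r.1.1 r.1.2)) g := by
      rw [← Polynomial.coe_aeval_eq_eval]
      change Polynomial.aeval u _ = _
      rw [← AlgHom.comp_apply, comp_aeval]
      simp [mul_comm u]
    have hzero : q * h = 0 := by
      refine Polynomial.funext fun u => ?_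
      rw [Polynomial.eval_mul, Polynomial.eval_zero, mul_eq_zero]
      refine or_iff_not_imp_left.mpr fun hu => ?_
      obtain ⟨B, C, hBC⟩ := hfac u hu
      rw [heval, ← aeval_coeff_mul_eq_zero_of_mem_ker hg B C]
      congr 2
      ext r
      have := PowerSeries.X_pow_dvd_iff.mp (hdet.trans (hBC r.1.1 r.1.2)) r.2 r.2.2
      rw [map_sub, sub_eq_zero] at this
      rw [← this, hpA]
      simp
    have h0 : h = 0 := (mul_eq_zero.mp hzero).resolve_left hq
    have := heval 0
    rw [h0] at this
    simpa using this.symm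

/-- over an algebraically closed field of characteristic zero, the radical of
the ideal of `s`-jets of the principal ideal generated by the determinant of the generic
`n × n` matrix is prime; i.e. the `s`-jet scheme of the determinantal hypersurface is
irreducible. -/
theorem jets_det_hypersurface_irreducible (k : Type*) [Field k] [IsAlgClosed k]
    [CharZero k] (n : ℕ) (hn : 1 ≤ n) (s : ℕ) :
    ((jetIdeal k s
        {Matrix.det (Matrix.of fun a b : Fin n =>
          (MvPolynomial.X (a, b) : MvPolynomial (Fin n × Fin n) k))}).radical).IsPrime := by
  obtain ⟨m, rfl⟩ := Nat.exists_eq_add_of_le' hn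
  rw [jetIdeal_det_radical_eq_ker]
  exact RingHom.ker_isPrime _
end

section
/- Let R = ℚ[x_{a,b} : 1 ≤ a,b ≤ 3] and let I ⊆ R be the ideal generated by the nine 2×2 minors of the generic 3×3 matrix X = (x_{a,b}). Then the ideal of 1-jets J_1(I) ⊆ ℚ[x_{a,b,j} : 1 ≤ a,b ≤ 3, 0 ≤ j ≤ 1] is a radical ideal with exactly two minimal primes, and one of these minimal primes is the ideal ⟨x_{a,b,0} : 1 ≤ a,b ≤ 3⟩ generated by the nine order-zero variables. -/
open MvPolynomial

/-- The set of the nine `2 × 2` minors of the generic `3 × 3` matrix `(x_{a,b})`. -/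
noncomputable def minors2x2 : Set (MvPolynomial (Fin 3 × Fin 3) ℚ) :=
  {g | ∃ r₁ r₂ c₁ c₂ : Fin 3, r₁ < r₂ ∧ c₁ < c₂ ∧
    g = MvPolynomial.X (r₁, c₁) * MvPolynomial.X (r₂, c₂) -
        MvPolynomial.X (r₁, c₂) * MvPolynomial.X (r₂, c₁)}

namespace JetMinors

/-- The variables of the ring of first-order jets of `3 × 3` matrices. -/
abbrev JetVar := (Fin 3 × Fin 3) × Fin (1 + 1)

/-- The ring of first-order jets of `3 × 3` matrices. -/
abbrev JetRing := MvPolynomial JetVar ℚ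

/-- The entry in row `a` and column `p` of the `3 × 6` matrix formed by the entries of the
two jet matrices. -/
noncomputable abbrev entry (a : Fin 3) (p : Fin 3 × Fin (1 + 1)) : JetRing := X ((a, p.1), p.2)

/-- The ideal of first-order jets of the `2 × 2` minors. -/
noncomputable abbrev jetMinors : Ideal JetRing := jetIdeal ℚ 1 minors2x2

/-- The ideal generated by the variables of order zero. -/
noncomputable abbrev zeroOrder : Ideal JetRing :=
  Ideal.span {g : MvPolynomial ((Fin 3 × Fin 3) × Fin (1 + 1)) ℚ |
    ∃ a b : Fin 3, g = X ((a, b), (0 : Fin (1 + 1)))}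

/-- The `2 × 2` minor of the order-zero matrix in rows `i, k` and columns `p, q`. -/
noncomputable def minorZero (i k p q : Fin 3) : JetRing :=
  entry i (p, 0) * entry k (q, 0) - entry i (q, 0) * entry k (p, 0)

/-- The first-order part of the `2 × 2` minor in rows `i, k` and columns `p, q`. -/
noncomputable def minorOne (i k p q : Fin 3) : JetRing :=
  entry i (p, 0) * entry k (q, 1) + entry i (p, 1) * entry k (q, 0)
    - entry i (q, 0) * entry k (p, 1) - entry i (q, 1) * entry k (p, 0)

lemma jetCoeff_minor_zero (i k p q : Fin 3) :
    jetCoeff ℚ 1 (X (i, p) * X (k, q) - X (i, q) * X (k, p)) 0 = minorZero i k p q := by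
  simp [jetCoeff, jetSub, minorZero, Fin.sum_univ_two, Polynomial.mul_coeff_zero]

lemma jetCoeff_minor_one (i k p q : Fin 3) :
    jetCoeff ℚ 1 (X (i, p) * X (k, q) - X (i, q) * X (k, p)) 1 = minorOne i k p q := by
  simp [jetCoeff, jetSub, minorOne, Fin.sum_univ_two, Polynomial.mul_coeff_one]
  ring

/-- The jet ideal is generated by the minors for ordered pairs of rows and columns. -/
lemma jetMinors_le {I : Ideal JetRing} (h₀ : ∀ i k p q, minorZero i k p q ∈ I)
    (h₁ : ∀ i k p q, minorOne i k p q ∈ I) : jetMinors ≤ I := by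
  refine Ideal.span_le.2 ?_
  rintro g ⟨f, ⟨i, k, p, q, -, -, rfl⟩, j, hj, rfl⟩
  interval_cases j
  · rw [jetCoeff_minor_zero]; exact h₀ i k p q
  · rw [jetCoeff_minor_one]; exact h₁ i k p q

lemma minor_mem_of_lt {m : Fin 3 → Fin 3 → Fin 3 → Fin 3 → JetRing} {I : Ideal JetRing}
    (hrow : ∀ i k p q, m k i p q = -m i k p q) (hcol : ∀ i k p q, m i k q p = -m i k p q)
    (h : ∀ i k p q, i < k → p < q → m i k p q ∈ I) (i k p q : Fin 3) : m i k p q ∈ I := by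
  have hself (a : JetRing) (ha : a = -a) : a ∈ I := by
    rw [self_eq_neg.1 ha]; exact I.zero_mem
  rcases lt_trichotomy i k with hik | rfl | hik
  · rcases lt_trichotomy p q with hpq | rfl | hpq
    · exact h i k p q hik hpq
    · exact hself _ (hcol i k p p)
    · rw [hcol]; exact I.neg_mem (h _ _ _ _ hik hpq)
  · exact hself _ (hrow i i p q)
  · rw [hrow]
    refine I.neg_mem ?_
    rcases lt_trichotomy p q with hpq | rfl | hpq
    · exact h _ _ p q hik hpq
    · exact hself _ (hcol _ _ p p)
    · rw [hcol]; exact I.neg_mem (h _ _ _ _ hik hpq)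

lemma minorZero_mem (i k p q : Fin 3) : minorZero i k p q ∈ jetMinors := by
  refine minor_mem_of_lt ?_ ?_ (fun i k p q hik hpq => ?_) i k p q
  · intros; simp only [minorZero]; ring
  · intros; simp only [minorZero]; ring
  · exact Ideal.subset_span
      ⟨_, ⟨i, k, p, q, hik, hpq, rfl⟩, 0, zero_le_one, (jetCoeff_minor_zero i k p q).symm⟩

lemma minorOne_mem (i k p q : Fin 3) : minorOne i k p q ∈ jetMinors := by
  refine minor_mem_of_lt ?_ ?_ (fun i k p q hik hpq => ?_) i k p q
  · intros; simp only [minorOne]; ring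
  · intros; simp only [minorOne]; ring
  · exact Ideal.subset_span
      ⟨_, ⟨i, k, p, q, hik, hpq, rfl⟩, 1, le_rfl, (jetCoeff_minor_one i k p q).symm⟩

/-! ### Membership of `3 × 3` determinants -/

/-- The determinant of the columns `p, q, r` of the `3 × 6` matrix of jet variables. -/
noncomputable def det3 (p q r : Fin 3 × Fin (1 + 1)) : JetRing :=
  entry 0 p * entry 1 q * entry 2 r - entry 0 p * entry 2 q * entry 1 r
    - entry 1 p * entry 0 q * entry 2 r + entry 1 p * entry 2 q * entry 0 r
    + entry 2 p * entry 0 q * entry 1 r - entry 2 p * entry 1 q * entry 0 r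

lemma det3_swap₁₂ (p q r : Fin 3 × Fin (1 + 1)) : det3 q p r = -det3 p q r := by
  simp only [det3]; ring

lemma det3_swap₂₃ (p q r : Fin 3 × Fin (1 + 1)) : det3 p r q = -det3 p q r := by
  simp only [det3]; ring

lemma det3_zero_zero_mem (p q : Fin 3) (r : Fin 3 × Fin (1 + 1)) :
    det3 (p, 0) (q, 0) r ∈ jetMinors := by
  have : det3 (p, 0) (q, 0) r = entry 2 r * minorZero 0 1 p q - entry 1 r * minorZero 0 2 p q
      + entry 0 r * minorZero 1 2 p q := by
    simp only [det3, minorZero]; ring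
  rw [this]
  exact add_mem (sub_mem (Ideal.mul_mem_left _ _ (minorZero_mem _ _ _ _))
    (Ideal.mul_mem_left _ _ (minorZero_mem _ _ _ _)))
    (Ideal.mul_mem_left _ _ (minorZero_mem _ _ _ _))

/-- Modulo the jet ideal, `x_p ∧ y_q ∧ y_r` is symmetric in `p` and `q`. -/
lemma det3_sub_mem (p q : Fin 3) (r : Fin 3 × Fin (1 + 1)) :
    det3 (p, 0) (q, 1) r - det3 (q, 0) (p, 1) r ∈ jetMinors := by
  have : det3 (p, 0) (q, 1) r - det3 (q, 0) (p, 1) r = entry 2 r * minorOne 0 1 p q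
      - entry 1 r * minorOne 0 2 p q + entry 0 r * minorOne 1 2 p q := by
    simp only [det3, minorOne]; ring
  rw [this]
  exact add_mem (sub_mem (Ideal.mul_mem_left _ _ (minorOne_mem _ _ _ _))
    (Ideal.mul_mem_left _ _ (minorOne_mem _ _ _ _)))
    (Ideal.mul_mem_left _ _ (minorOne_mem _ _ _ _))

lemma mem_of_two_mul_mem {I : Ideal JetRing} {f : JetRing} (h : 2 * f ∈ I) : f ∈ I := by
  have h' := I.mul_mem_left (C (1 / 2 : ℚ)) h
  rwa [← mul_assoc, show (2 : JetRing) = C (2 : ℚ) from (map_ofNat C 2).symm, ← C_mul,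
    show (1 / 2 * 2 : ℚ) = 1 by norm_num, C_1, one_mul] at h'

lemma det3_zero_one_one_mem (p q r : Fin 3) : det3 (p, 0) (q, 1) (r, 1) ∈ jetMinors := by
  refine mem_of_two_mul_mem ?_
  have : 2 * det3 (p, 0) (q, 1) (r, 1) =
      (det3 (p, 0) (q, 1) (r, 1) - det3 (q, 0) (p, 1) (r, 1))
      - (det3 (q, 0) (r, 1) (p, 1) - det3 (r, 0) (q, 1) (p, 1))
      + (det3 (r, 0) (p, 1) (q, 1) - det3 (p, 0) (r, 1) (q, 1)) := by
    rw [det3_swap₂₃ (q, 0) (p, 1) (r, 1), det3_swap₂₃ (r, 0) (p, 1) (q, 1),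
      det3_swap₂₃ (p, 0) (q, 1) (r, 1)]
    ring
  rw [this]
  exact add_mem (sub_mem (det3_sub_mem _ _ _) (det3_sub_mem _ _ _)) (det3_sub_mem _ _ _)

lemma det3_mem_of_zero (p : Fin 3) (q r : Fin 3 × Fin (1 + 1)) :
    det3 (p, 0) q r ∈ jetMinors := by
  obtain ⟨q, j⟩ := q
  obtain ⟨r, k⟩ := r
  fin_cases j
  · exact det3_zero_zero_mem p q _
  · fin_cases k
    · rw [det3_swap₂₃ (p, 0) (r, _)]
      exact neg_mem (det3_zero_zero_mem p r _)
    · exact det3_zero_one_one_mem p q r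

/-- Cramer's rule moves an order-zero entry into the determinant. -/
lemma entry_mul_det3_mem (i s : Fin 3) (p q r : Fin 3 × Fin (1 + 1)) :
    entry i (s, 0) * det3 p q r ∈ jetMinors := by
  have : entry i (s, 0) * det3 p q r = entry i p * det3 (s, 0) q r
      - entry i q * det3 (s, 0) p r + entry i r * det3 (s, 0) p q := by
    fin_cases i <;> simp only [det3, Fin.zero_eta, Fin.mk_one, Fin.reduceFinMk] <;> ring
  rw [this]
  exact add_mem (sub_mem (Ideal.mul_mem_left _ _ (det3_mem_of_zero _ _ _))
    (Ideal.mul_mem_left _ _ (det3_mem_of_zero _ _ _)))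
    (Ideal.mul_mem_left _ _ (det3_mem_of_zero _ _ _))

lemma mul_det3_mem {g : JetRing} (hg : g ∈ zeroOrder) (p q r : Fin 3 × Fin (1 + 1)) :
    g * det3 p q r ∈ jetMinors := by
  induction hg using Submodule.span_induction with
  | mem _ h =>
    obtain ⟨a, b, rfl⟩ := h
    exact entry_mul_det3_mem a b p q r
  | zero => simp
  | add _ _ _ _ hx hy => rw [add_mul]; exact add_mem hx hy
  | smul c _ _ h => rw [smul_eq_mul, mul_assoc]; exact Ideal.mul_mem_left _ _ h

/-! ### Stability under derivations -/

lemma derivation_mem_span {δ : Derivation ℚ JetRing JetRing} {s : Set JetRing}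
    (h : ∀ g ∈ s, δ g ∈ Ideal.span s) {f : JetRing} (hf : f ∈ Ideal.span s) :
    δ f ∈ Ideal.span s := by
  induction hf using Submodule.span_induction with
  | mem g hg => exact h g hg
  | zero => simp
  | add _ _ _ _ hx hy => rw [map_add]; exact add_mem hx hy
  | smul c x hx h' =>
    rw [smul_eq_mul, Derivation.leibniz, smul_eq_mul, smul_eq_mul]
    exact add_mem (Ideal.mul_mem_left _ _ h') (Ideal.mul_mem_right _ _ hx)

lemma pderiv_mem_zeroOrder (a b : Fin 3) {f : JetRing} (hf : f ∈ zeroOrder) :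
    pderiv ((a, b), 1) f ∈ zeroOrder := by
  refine derivation_mem_span ?_ hf
  rintro _ ⟨a', b', rfl⟩
  rw [pderiv_X_of_ne (by simp)]
  exact zero_mem _

/-- The row polarization operator, the derivation replacing the entries of row `k` by those of
row `i`. -/
noncomputable def polarize (i k : Fin 3) : Derivation ℚ JetRing JetRing :=
  mkDerivation ℚ fun v => if v.1.1 = k then X ((i, v.1.2), v.2) else 0

lemma polarize_X (i k : Fin 3) (v : JetVar) :
    polarize i k (X v) = if v.1.1 = k then X ((i, v.1.2), v.2) else 0 := by
  simp [polarize, mkDerivation_X]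

lemma polarize_entry (i k a : Fin 3) (p : Fin 3 × Fin (1 + 1)) :
    polarize i k (entry a p) = if a = k then entry i p else 0 :=
  polarize_X i k _

lemma polarize_apply (i k : Fin 3) (f : JetRing) :
    polarize i k f = ∑ p : Fin 3 × Fin (1 + 1), entry i p * pderiv ((k, p.1), p.2) f := by
  have : polarize i k = ∑ p : Fin 3 × Fin (1 + 1), entry i p • pderiv ((k, p.1), p.2) := by
    refine derivation_ext fun ⟨⟨a, b⟩, j⟩ => ?_
    rw [polarize_X, ← Derivation.coeFnAddMonoidHom_apply, map_sum, Finset.sum_apply,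
      Finset.sum_eq_single (b, j)]
    · simp [pderiv_X, Pi.single_apply, eq_comm]
    · rintro ⟨b', j'⟩ - h
      simp only [Derivation.coeFnAddMonoidHom_apply, Derivation.smul_apply]
      rw [pderiv_X_of_ne, smul_zero]
      grind
    · simp
  rw [this, ← Derivation.coeFnAddMonoidHom_apply, map_sum, Finset.sum_apply]
  rfl

lemma polarize_mem_jetMinors (i k : Fin 3) {f : JetRing} (hf : f ∈ jetMinors) :
    polarize i k f ∈ jetMinors := by
  have h₀ (a b p q : Fin 3) : polarize i k (minorZero a b p q) =
      (if a = k then minorZero i b p q else 0) + if b = k then minorZero a i p q else 0 := by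
    simp only [minorZero, map_sub, Derivation.leibniz, polarize_entry, smul_eq_mul]
    split_ifs <;> ring
  have h₁ (a b p q : Fin 3) : polarize i k (minorOne a b p q) =
      (if a = k then minorOne i b p q else 0) + if b = k then minorOne a i p q else 0 := by
    simp only [minorOne, map_sub, map_add, Derivation.leibniz, polarize_entry, smul_eq_mul]
    split_ifs <;> ring
  refine derivation_mem_span ?_ hf
  rintro g ⟨f, ⟨a, b, p, q, -, -, rfl⟩, j, hj, rfl⟩
  change _ ∈ jetMinors
  interval_cases j
  · rw [jetCoeff_minor_zero, h₀]
    refine add_mem ?_ ?_ <;> split_ifs <;> first | exact minorZero_mem _ _ _ _ | exact zero_mem _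
  · rw [jetCoeff_minor_one, h₁]
    refine add_mem ?_ ?_ <;> split_ifs <;> first | exact minorOne_mem _ _ _ _ | exact zero_mem _

/-! ### The Capelli operator -/

/-- The Capelli operator for the three rows of the `3 × 6` matrix of jet variables. -/
noncomputable def capelli (f : JetRing) : JetRing :=
  ∑ q : Fin 3 × Fin (1 + 1), ∑ r : Fin 3 × Fin (1 + 1), ∑ p : Fin 3 × Fin (1 + 1),
    det3 p q r * pderiv ((0, p.1), p.2) (pderiv ((1, q.1), q.2) (pderiv ((2, r.1), r.2) f))

lemma capelli_mem {f : JetRing} (hf : f ∈ zeroOrder) : capelli f ∈ jetMinors := by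
  refine Ideal.sum_mem _ fun ⟨q, j⟩ _ => Ideal.sum_mem _ fun ⟨r, k⟩ _ =>
    Ideal.sum_mem _ fun ⟨p, l⟩ _ => ?_
  have key : det3 (p, l) (q, j) (r, k) ∈ jetMinors ∨ (j = 1 ∧ k = 1 ∧ l = 1) := by
    by_cases hl : l = 0
    · subst hl; exact .inl (det3_mem_of_zero _ _ _)
    by_cases hj : j = 0
    · subst hj
      rw [det3_swap₁₂]
      exact .inl (neg_mem (det3_mem_of_zero _ _ _))
    by_cases hk : k = 0
    · subst hk
      rw [det3_swap₂₃, det3_swap₁₂, neg_neg]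
      exact .inl (det3_mem_of_zero _ _ _)
    exact .inr ⟨by grind, by grind, by grind⟩
  rcases key with h | ⟨rfl, rfl, rfl⟩
  · exact Ideal.mul_mem_right _ _ h
  · rw [mul_comm]
    exact mul_det3_mem (pderiv_mem_zeroOrder _ _ (pderiv_mem_zeroOrder _ _
      (pderiv_mem_zeroOrder _ _ hf))) _ _ _

/-- The normally ordered product of two polarization operators. -/
noncomputable def normal₂ (b c : Fin 3) (f : JetRing) : JetRing :=
  ∑ q : Fin 3 × Fin (1 + 1), entry b q * ∑ r : Fin 3 × Fin (1 + 1), entry c r *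
    pderiv ((1, q.1), q.2) (pderiv ((2, r.1), r.2) f)

/-- The normally ordered product of three polarization operators. -/
noncomputable def normal₃ (a b c : Fin 3) (f : JetRing) : JetRing :=
  ∑ q : Fin 3 × Fin (1 + 1), entry b q * ∑ r : Fin 3 × Fin (1 + 1), entry c r *
    ∑ p : Fin 3 × Fin (1 + 1), entry a p *
      pderiv ((0, p.1), p.2) (pderiv ((1, q.1), q.2) (pderiv ((2, r.1), r.2) f))

lemma polarize_sum (a k b : Fin 3) (g : Fin 3 × Fin (1 + 1) → JetRing) :
    polarize a k (∑ q, entry b q * g q) =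
      (if b = k then ∑ q, entry a q * g q else 0) + ∑ q, entry b q * polarize a k (g q) := by
  rw [map_sum]
  simp only [Derivation.leibniz, polarize_entry, smul_eq_mul, Finset.sum_add_distrib]
  split_ifs <;> simp [mul_comm, add_comm]

lemma normal₂_eq (b c : Fin 3) (f : JetRing) :
    normal₂ b c f = polarize b 1 (polarize c 2 f) - if c = 1 then polarize b 2 f else 0 := by
  rw [polarize_apply c 2, polarize_sum, polarize_apply b 2, normal₂]
  simp only [polarize_apply, Finset.mul_sum]
  rw [Finset.sum_comm, add_sub_cancel_left]
  refine Finset.sum_congr rfl fun q _ => Finset.sum_congr rfl fun r _ => ?_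
  ring

lemma normal₃_eq (a b c : Fin 3) (f : JetRing) :
    normal₃ a b c f = polarize a 0 (normal₂ b c f) - (if b = 0 then normal₂ a c f else 0)
      - if c = 0 then normal₂ b a f else 0 := by
  conv_rhs => enter [1, 1]; rw [normal₂]
  simp only [polarize_sum, mul_add, Finset.sum_add_distrib]
  simp only [polarize_apply a 0]
  split_ifs <;> simp [normal₂, normal₃]

lemma capelli_eq_normal (f : JetRing) :
    capelli f = normal₃ 0 1 2 f - normal₃ 0 2 1 f - normal₃ 1 0 2 f + normal₃ 1 2 0 f
      + normal₃ 2 0 1 f - normal₃ 2 1 0 f := by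
  simp only [normal₃, capelli, Finset.mul_sum, ← Finset.sum_sub_distrib,
    ← Finset.sum_add_distrib]
  refine Finset.sum_congr rfl fun q _ => Finset.sum_congr rfl fun r _ =>
    Finset.sum_congr rfl fun p _ => ?_
  rw [det3]
  ring

/-- The Capelli identity for a polynomial of row degree `(l, m, n)` annihilated, modulo the jet
ideal, by the raising polarizations. -/
lemma capelli_sub_smul_mem {f : JetRing} {l m n : ℕ} (h0 : polarize 0 0 f = l • f)
    (h1 : polarize 1 1 f = m • f) (h2 : polarize 2 2 f = n • f)
    (h01 : polarize 0 1 f ∈ jetMinors) (h02 : polarize 0 2 f ∈ jetMinors)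
    (h12 : polarize 1 2 f ∈ jetMinors) :
    capelli f - ((l + 2) * (m + 1) * n) • f ∈ jetMinors := by
  have n12 : normal₂ 1 2 f = (n * m) • f := by
    simp [normal₂_eq, h1, h2, mul_assoc]
  have n21 : normal₂ 2 1 f = polarize 2 1 (polarize 1 2 f) - n • f := by
    simp [normal₂_eq, h2]
  have n02 : normal₂ 0 2 f ∈ jetMinors := by
    simpa [normal₂_eq, h2] using Ideal.mul_mem_left _ _ h01
  have n20 : normal₂ 2 0 f ∈ jetMinors := by
    simpa [normal₂_eq] using polarize_mem_jetMinors 2 1 h02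
  have n01 : normal₂ 0 1 f ∈ jetMinors := by
    simpa [normal₂_eq] using sub_mem (polarize_mem_jetMinors 0 1 h12) h02
  have n10 : normal₂ 1 0 f ∈ jetMinors := by
    simpa [normal₂_eq] using polarize_mem_jetMinors 1 1 h02
  have h21 := polarize_mem_jetMinors 2 1 h12
  have h021 := polarize_mem_jetMinors 0 0 h21
  have key : capelli f - ((l + 2) * (m + 1) * n) • f =
      polarize 2 0 (normal₂ 0 1 f) - polarize 2 0 (normal₂ 1 0 f) - polarize 1 0 (normal₂ 0 2 f)
        + polarize 1 0 (normal₂ 2 0 f) - polarize 0 0 (polarize 2 1 (polarize 1 2 f))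
        - 2 * polarize 2 1 (polarize 1 2 f) := by
    rw [capelli_eq_normal]
    simp only [normal₃_eq, n12, n21, map_sub, map_nsmul, h0]
    simp
    ring
  rw [key]
  exact sub_mem (sub_mem (add_mem (sub_mem (sub_mem (polarize_mem_jetMinors _ _ n01)
    (polarize_mem_jetMinors _ _ n10)) (polarize_mem_jetMinors _ _ n02))
    (polarize_mem_jetMinors _ _ n20)) h021) (Ideal.mul_mem_left _ _ h21)
/-! ### Reduction to two rows -/

/-- The grading by row degrees. -/
def rowWeight (v : JetVar) : Fin 3 → ℕ := Pi.single v.1.1 1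

lemma row_notMem_vars {f : JetRing} {n : Fin 3 → ℕ} (hf : IsWeightedHomogeneous rowWeight f n)
    {v : JetVar} (hv : n v.1.1 = 0) : v ∉ f.vars := by
  rw [mem_vars_iff_mem_support]
  rintro ⟨d, hd, hvd⟩
  have h := Finsupp.le_weight_of_ne_zero' rowWeight (Finsupp.mem_support_iff.1 hvd) v.1.1
  rw [hf (mem_support_iff.1 hd), hv] at h
  simp [rowWeight] at h

lemma polarize_self {f : JetRing} {n : Fin 3 → ℕ} (hf : IsWeightedHomogeneous rowWeight f n)
    (k : Fin 3) : polarize k k f = n k • f := by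
  have hk : IsWeightedHomogeneous (fun v => rowWeight v k) f (n k) := by
    intro d hd
    rw [← hf hd, Finsupp.weight_apply, Finsupp.weight_apply, Finsupp.sum, Finsupp.sum,
      Finset.sum_apply]
    rfl
  rw [← hk.sum_weight_X_mul_pderiv, polarize_apply]
  simp only [Fintype.sum_prod_type, rowWeight, Pi.single_apply, ite_smul, one_smul, zero_smul]
  rw [Finset.sum_comm]
  conv_rhs => rw [Finset.sum_comm]
  simp [Finset.sum_add_distrib]

lemma single_one_le {n : Fin 3 → ℕ} {k : Fin 3} (hk : n k ≠ 0) : Pi.single k 1 ≤ n := by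
  intro j
  rw [Pi.single_apply]
  split_ifs with h
  · exact h ▸ Nat.one_le_iff_ne_zero.2 hk
  · exact Nat.zero_le _

lemma polarize_isWeightedHomogeneous {f : JetRing} {n m : Fin 3 → ℕ}
    (hf : IsWeightedHomogeneous rowWeight f n) (i k : Fin 3)
    (hm : m + Pi.single k 1 = n + Pi.single i 1) (hk : n k ≠ 0) :
    IsWeightedHomogeneous rowWeight (polarize i k f) m := by
  rw [polarize_apply]
  refine IsWeightedHomogeneous.sum _ _ _ fun p _ => ?_
  have hn : (n - Pi.single k 1) + Pi.single k 1 = n :=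
    tsub_add_cancel_of_le (single_one_le hk)
  convert (isWeightedHomogeneous_X ℚ rowWeight ((i, p.1), p.2)).mul
    (hf.pderiv (i := ((k, p.1), p.2)) hn) using 1
  refine add_right_cancel (b := Pi.single k 1) ?_
  rw [hm, add_assoc, hn, add_comm]
  rfl

lemma polarize_eq_zero {f : JetRing} {n : Fin 3 → ℕ} (hf : IsWeightedHomogeneous rowWeight f n)
    (i k : Fin 3) (hk : n k = 0) : polarize i k f = 0 := by
  rw [polarize_apply]
  refine Finset.sum_eq_zero fun p _ => ?_
  rw [pderiv_eq_zero_of_notMem_vars (row_notMem_vars hf (by exact hk)), mul_zero]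

/-- A space of polynomials stable under polarizations and row components lies in the jet ideal
as soon as its elements not involving the last row do. -/
theorem mem_jetMinors_of_rows {P : JetRing → Prop} (hzero : ∀ f, P f → f ∈ zeroOrder)
    (hpol : ∀ i k f, P f → P (polarize i k f))
    (hcomp : ∀ n f, P f → P (weightedHomogeneousComponent rowWeight n f))
    (hbase : ∀ f, P f → (∀ v ∈ f.vars, v.1.1 ≠ 2) → f ∈ jetMinors) {f : JetRing} (hf : P f) :
    f ∈ jetMinors := by
  have homog (N : ℕ) : ∀ (n : Fin 3 → ℕ) (f : JetRing), P f →
      IsWeightedHomogeneous rowWeight f n → 2 * n 2 + n 1 = N → f ∈ jetMinors := by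
    induction N using Nat.strong_induction_on with
    | _ N ih =>
      intro n f hPf hf hN
      by_cases h2 : n 2 = 0
      · exact hbase f hPf fun v hv h => row_notMem_vars hf (h ▸ h2) hv
      have raise (i k : Fin 3) (hik : i < k) : polarize i k f ∈ jetMinors := by
        by_cases hk : n k = 0
        · rw [polarize_eq_zero hf i k hk]; exact zero_mem _
        have hle : Pi.single k 1 ≤ n := single_one_le hk
        refine ih _ ?_ (n - Pi.single k 1 + Pi.single i 1) _ (hpol i k f hPf)
          (polarize_isWeightedHomogeneous hf i k ?_ hk) rfl
        · fin_cases i <;> fin_cases k <;> simp_all <;> omega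
        · rw [add_right_comm, tsub_add_cancel_of_le hle]
      have h := sub_mem (capelli_mem (hzero f hPf)) (capelli_sub_smul_mem (polarize_self hf 0)
        (polarize_self hf 1) (polarize_self hf 2) (raise 0 1 (by decide)) (raise 0 2 (by decide))
        (raise 1 2 (by decide)))
      rw [sub_sub_cancel] at h
      have hne : (((n 0 + 2) * (n 1 + 1) * n 2 : ℕ) : ℚ) ≠ 0 := by
        simp only [ne_eq, Nat.cast_eq_zero]; positivity
      convert Ideal.mul_mem_left _ (C (((n 0 + 2) * (n 1 + 1) * n 2 : ℕ) : ℚ)⁻¹) h using 1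
      rw [nsmul_eq_mul, ← mul_assoc, ← map_natCast C, ← C_mul, inv_mul_cancel₀ hne, C_1, one_mul]
  rw [← sum_weightedHomogeneousComponent rowWeight f,
    finsum_eq_sum _ (weightedHomogeneousComponent_finsupp f)]
  exact Ideal.sum_mem _ fun n _ => homog _ n _ (hcomp n f hf)
    (weightedHomogeneousComponent_isWeightedHomogeneous n f) rfl

/-! ### Homomorphisms compatible with row degrees and polarizations -/

lemma isWeightedHomogeneous_aeval_monomial {σ τ M : Type*} [AddCommMonoid M] {w : σ → M}
    {w' : τ → M} {h : σ → MvPolynomial τ ℚ} (hh : ∀ i, IsWeightedHomogeneous w' (h i) (w i))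
    (d : σ →₀ ℕ) (c : ℚ) :
    IsWeightedHomogeneous w' (aeval h (monomial d c)) (Finsupp.weight w d) := by
  rw [aeval_monomial]
  exact IsWeightedHomogeneous.C_mul
    (IsWeightedHomogeneous.prod _ _ _ fun i _ => (hh i).pow (d i)) c

lemma weightedHomogeneousComponent_aeval {σ τ M : Type*} [AddCommMonoid M] {w : σ → M}
    {w' : τ → M} {h : σ → MvPolynomial τ ℚ} (hh : ∀ i, IsWeightedHomogeneous w' (h i) (w i))
    (n : M) (f : MvPolynomial σ ℚ) :
    weightedHomogeneousComponent w' n (aeval h f) =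
      aeval h (weightedHomogeneousComponent w n f) := by
  induction f using MvPolynomial.induction_on' with
  | monomial d c =>
    have hd := isWeightedHomogeneous_aeval_monomial hh d c
    have hd' := isWeightedHomogeneous_monomial w d c rfl
    by_cases hn : Finsupp.weight w d = n
    · rw [← hn, hd.weightedHomogeneousComponent_same, hd'.weightedHomogeneousComponent_same]
    · rw [hd.weightedHomogeneousComponent_ne n (Ne.symm hn),
        hd'.weightedHomogeneousComponent_ne n (Ne.symm hn), map_zero]
  | add p q hp hq => simp only [map_add, hp, hq]

lemma aeval_derivation {σ τ : Type*} {h : σ → MvPolynomial τ ℚ}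
    {δ : Derivation ℚ (MvPolynomial σ ℚ) (MvPolynomial σ ℚ)}
    {δ' : Derivation ℚ (MvPolynomial τ ℚ) (MvPolynomial τ ℚ)}
    (hδ : ∀ i, aeval h (δ (X i)) = δ' (h i)) (f : MvPolynomial σ ℚ) :
    aeval h (δ f) = δ' (aeval h f) := by
  induction f using MvPolynomial.induction_on with
  | C a => simp [derivation_C]
  | add p q hp hq => simp only [map_add, hp, hq]
  | mul_X p i hp => simp only [Derivation.leibniz, map_add, map_mul, smul_eq_mul, aeval_X, hp, hδ]

/-- The substitution setting the variables outside `S` to zero. -/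
noncomputable def restrict (S : JetVar → Prop) [DecidablePred S] : JetRing →ₐ[ℚ] JetRing :=
  aeval fun v => if S v then X v else 0

lemma restrict_X (S : JetVar → Prop) [DecidablePred S] (v : JetVar) :
    restrict S (X v) = if S v then X v else 0 := by
  simp [restrict]

lemma restrict_eq_self {S : JetVar → Prop} [DecidablePred S] {f : JetRing}
    (hf : ∀ v ∈ f.vars, S v) : restrict S f = f := by
  conv_rhs => rw [← aeval_X_left_apply f]
  exact eval₂Hom_congr' rfl (fun v hv _ => if_pos (hf v hv)) rfl

lemma sub_restrict_mem {S : JetVar → Prop} [DecidablePred S] {I : Ideal JetRing}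
    (hI : ∀ v, ¬ S v → X v ∈ I) (f : JetRing) : f - restrict S f ∈ I := by
  rw [← Ideal.Quotient.eq_zero_iff_mem, map_sub, sub_eq_zero]
  suffices (Ideal.Quotient.mkₐ ℚ I) = (Ideal.Quotient.mkₐ ℚ I).comp (restrict S) from
    DFunLike.congr_fun this f
  refine algHom_ext fun v => ?_
  rw [AlgHom.comp_apply, restrict_X]
  split_ifs with h
  · rfl
  · rw [map_zero]
    exact Ideal.Quotient.eq_zero_iff_mem.2 (hI v h)

lemma restrict_weightedHomogeneousComponent (S : JetVar → Prop) [DecidablePred S]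
    (n : Fin 3 → ℕ) (f : JetRing) :
    weightedHomogeneousComponent rowWeight n (restrict S f) =
      restrict S (weightedHomogeneousComponent rowWeight n f) := by
  refine weightedHomogeneousComponent_aeval (fun v => ?_) n f
  split_ifs
  · exact isWeightedHomogeneous_X _ _ _
  · exact isWeightedHomogeneous_zero _ _ _

lemma restrict_polarize {S : JetVar → Prop} [DecidablePred S]
    (hS : ∀ a a' b j, S ((a, b), j) → S ((a', b), j)) (i k : Fin 3) (f : JetRing) :
    restrict S (polarize i k f) = polarize i k (restrict S f) := by
  refine aeval_derivation (fun ⟨⟨a, b⟩, j⟩ => ?_) f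
  have h : S ((a, b), j) ↔ S ((i, b), j) := ⟨hS a i b j, hS i a b j⟩
  rw [apply_ite (polarize i k), map_zero, polarize_X]
  change restrict S _ = _
  rw [apply_ite (restrict S), restrict_X, map_zero]
  split_ifs <;> simp_all

lemma mem_zeroOrder_iff {f : JetRing} : f ∈ zeroOrder ↔ restrict (fun v => v.2 = 1) f = 0 := by
  constructor
  · intro hf
    suffices zeroOrder ≤ RingHom.ker (restrict fun v => v.2 = 1) from this hf
    refine Ideal.span_le.2 ?_
    rintro _ ⟨a, b, rfl⟩
    simp [RingHom.mem_ker, restrict_X]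
  · intro hf
    have := sub_restrict_mem (S := fun v => v.2 = 1) (I := zeroOrder) ?_ f
    · rwa [hf, sub_zero] at this
    · rintro ⟨⟨a, b⟩, j⟩ hj
      obtain rfl : j = 0 := by grind
      exact Ideal.subset_span ⟨a, b, rfl⟩

/-- The coordinates `u, u', v, v'` of the tangent bundle of the variety of matrices of rank one.
An index records the side, the order, and the position. -/
abbrev ParamRing := MvPolynomial (Fin 2 × Fin 2 × Fin 3) ℚ

/-- The parametrization `x ↦ u vᵀ`, `y ↦ u' vᵀ + u v'ᵀ` of the tangent bundle of the variety
of matrices of rank one. -/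
noncomputable def param : JetRing →ₐ[ℚ] ParamRing :=
  aeval fun v => if v.2 = 0 then X (0, 0, v.1.1) * X (1, 0, v.1.2)
    else X (0, 1, v.1.1) * X (1, 0, v.1.2) + X (0, 0, v.1.1) * X (1, 1, v.1.2)

lemma param_zero (a b : Fin 3) : param (X ((a, b), 0)) = X (0, 0, a) * X (1, 0, b) := by
  simp [param]

lemma param_one (a b : Fin 3) : param (X ((a, b), 1)) =
    X (0, 1, a) * X (1, 0, b) + X (0, 0, a) * X (1, 1, b) := by
  simp [param]

lemma param_weightedHomogeneousComponent (n : Fin 3 → ℕ) (f : JetRing) :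
    weightedHomogeneousComponent
        (fun t : Fin 2 × Fin 2 × Fin 3 => if t.1 = 0 then Pi.single t.2.2 1 else 0) n (param f) =
      param (weightedHomogeneousComponent rowWeight n f) := by
  refine weightedHomogeneousComponent_aeval (fun ⟨⟨a, b⟩, j⟩ => ?_) n f
  have h (s t : Fin 2) : IsWeightedHomogeneous
      (fun t : Fin 2 × Fin 2 × Fin 3 => if t.1 = 0 then Pi.single t.2.2 1 else 0)
      (X (0, s, a) * X (1, t, b) : ParamRing) (rowWeight ((a, b), j)) := by
    convert (isWeightedHomogeneous_X ℚ _ _).mul (isWeightedHomogeneous_X ℚ _ _) using 1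
    simp [rowWeight]
  split_ifs
  · exact h 0 0
  · exact (h 1 0).add (h 0 1)

/-- The derivation of the parameter ring corresponding to a row polarization. -/
noncomputable def polarizeParam (i k : Fin 3) : Derivation ℚ ParamRing ParamRing :=
  mkDerivation ℚ fun t => if t.1 = 0 ∧ t.2.2 = k then X (0, t.2.1, i) else 0

lemma param_polarize (i k : Fin 3) (f : JetRing) :
    param (polarize i k f) = polarizeParam i k (param f) := by
  refine aeval_derivation (fun ⟨⟨a, b⟩, j⟩ => ?_) f
  change param (polarize i k (X ((a, b), j))) = _
  rw [polarize_X]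
  by_cases hj : j = 0
  · subst hj
    by_cases ha : a = k <;>
      simp [ha, param_zero, polarizeParam, mkDerivation_X, mul_comm]
  · obtain rfl : j = 1 := by grind
    by_cases ha : a = k <;>
      simp [ha, param_one, polarizeParam, mkDerivation_X, mul_comm]

lemma jetMinors_le_ker_param : jetMinors ≤ RingHom.ker param := by
  refine jetMinors_le (fun i k p q => ?_) fun i k p q => ?_
  · simp only [RingHom.mem_ker, minorZero, entry, map_sub, map_mul, param_zero]; ring
  · simp only [RingHom.mem_ker, minorOne, entry, map_sub, map_add, map_mul, param_zero,
      param_one]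
    ring

lemma jetMinors_le_zeroOrder : jetMinors ≤ zeroOrder := by
  have h (a b : Fin 3) : entry a (b, 0) ∈ zeroOrder := Ideal.subset_span ⟨a, b, rfl⟩
  refine jetMinors_le (fun i k p q => ?_) fun i k p q => ?_
  · exact sub_mem (Ideal.mul_mem_right _ _ (h _ _)) (Ideal.mul_mem_right _ _ (h _ _))
  · exact sub_mem (sub_mem (add_mem (Ideal.mul_mem_right _ _ (h _ _))
      (Ideal.mul_mem_left _ _ (h _ _))) (Ideal.mul_mem_right _ _ (h _ _)))
      (Ideal.mul_mem_left _ _ (h _ _))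

/-! ### The case of `2 × 2` matrices -/

/-- The ideal generated by the minors of the upper left `2 × 2` blocks. -/
noncomputable abbrev blockMinors : Ideal JetRing :=
  Ideal.span {minorZero 0 1 0 1, minorOne 0 1 0 1}

lemma blockMinors_le : blockMinors ≤ jetMinors := by
  rw [Ideal.span_le, Set.pair_subset_iff]
  exact ⟨minorZero_mem _ _ _ _, minorOne_mem _ _ _ _⟩

lemma mem_blockMinors_of_mul_mem {f : JetRing} (h : X ((0, 0), 0) * f ∈ blockMinors) :
    f ∈ blockMinors := by
  obtain ⟨a, b, hab⟩ := Ideal.mem_span_pair.1 h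
  set ψ := restrict fun v => v ≠ ((0, 0), 0) with hψ
  have hsub (g : JetRing) : X ((0, 0), 0) ∣ g - ψ g := by
    rw [← Ideal.mem_span_singleton]
    refine sub_restrict_mem (fun v hv => ?_) g
    rw [not_not.1 hv]
    exact Ideal.mem_span_singleton_self _
  have hD : ψ (minorZero 0 1 0 1) = -(X ((0, 1), 0) * X ((1, 0), 0)) := by
    simp [hψ, minorZero, entry, restrict_X]
  have hP : ψ (minorOne 0 1 0 1) = X ((0, 0), 1) * X ((1, 1), 0)
      - X ((0, 1), 0) * X ((1, 0), 1) - X ((0, 1), 1) * X ((1, 0), 0) := by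
    simp [hψ, minorOne, entry, restrict_X]
  have hndvd {v : JetVar} (hv : v = ((0, 1), 0) ∨ v = ((1, 0), 0)) :
      ¬ X v ∣ ψ (minorOne 0 1 0 1) := by
    intro hdvd
    have := map_dvd (eval fun w : JetVar => if w = ((0, 0), 1) ∨ w = ((1, 1), 0) then 1 else 0)
      hdvd
    rw [hP] at this
    rcases hv with rfl | rfl <;> simp at this
  have h0 := congrArg ψ hab
  rw [map_add, map_mul, map_mul, map_mul, hD, hψ, restrict_X, if_neg (by simp), zero_mul,
    ← hψ] at h0
  obtain ⟨b₁, hb₁⟩ := ((X_prime (R := ℚ)).dvd_or_dvd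
    (show X ((0, 1), 0) ∣ ψ b * ψ (minorOne 0 1 0 1) from
      ⟨ψ a * X ((1, 0), 0), by linear_combination h0⟩)).resolve_right (hndvd (Or.inl rfl))
  have h1 : b₁ * ψ (minorOne 0 1 0 1) = ψ a * X ((1, 0), 0) := by
    refine mul_left_cancel₀ (X_ne_zero (R := ℚ) ((0, 1), 0)) ?_
    rw [hb₁] at h0
    linear_combination h0
  obtain ⟨c, rfl⟩ := ((X_prime (R := ℚ)).dvd_or_dvd
    (show X ((1, 0), 0) ∣ b₁ * ψ (minorOne 0 1 0 1) from
      ⟨ψ a, by linear_combination h1⟩)).resolve_right (hndvd (Or.inr rfl))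
  have h2 : c * ψ (minorOne 0 1 0 1) = ψ a := by
    refine mul_left_cancel₀ (X_ne_zero (R := ℚ) ((1, 0), 0)) ?_
    linear_combination h1
  obtain ⟨a', ha'⟩ := hsub a
  obtain ⟨b', hb'⟩ := hsub b
  obtain ⟨d, hd⟩ := hsub (minorZero 0 1 0 1)
  obtain ⟨e, he⟩ := hsub (minorOne 0 1 0 1)
  refine Ideal.mem_span_pair.2 ⟨a' - c * e, b' + c * d, ?_⟩
  refine mul_left_cancel₀ (X_ne_zero (R := ℚ) ((0, 0), 0)) ?_
  linear_combination hab - minorZero 0 1 0 1 * (ha' - h2) + minorZero 0 1 0 1 * c * he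
    - minorOne 0 1 0 1 * (hb' + hb₁) - minorOne 0 1 0 1 * c * (hd + hD)

lemma mem_blockMinors_of_pow_mul_mem {f : JetRing} (N : ℕ)
    (h : X ((0, 0), 0) ^ N * f ∈ blockMinors) : f ∈ blockMinors := by
  induction N with
  | zero => simpa using h
  | succ N ih =>
    rw [pow_succ', mul_assoc] at h
    exact ih (mem_blockMinors_of_mul_mem h)

/-- The variables in the hook at the upper left corner. -/
abbrev InHook (v : JetVar) : Prop := v.1 = (0, 0) ∨ v.1 = (0, 1) ∨ v.1 = (1, 0)

lemma exists_pow_mul_sub_mem (f : JetRing) : ∃ (N : ℕ) (g : JetRing),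
    X ((0, 0), 0) ^ N * restrict (fun v => v.1.1 ≠ 2) (restrict (fun v => v.1.2 ≠ 2) f)
      - restrict InHook g ∈ blockMinors := by
  have hX : restrict InHook (X ((0, 0), 0)) = X ((0, 0), 0) := by simp [restrict_X]
  have hmul {f f' : JetRing}
      (hf : ∃ (N : ℕ) (g : JetRing), X ((0, 0), 0) ^ N * f - restrict InHook g ∈ blockMinors)
      (hf' : ∃ (N : ℕ) (g : JetRing), X ((0, 0), 0) ^ N * f' - restrict InHook g ∈ blockMinors) :
      ∃ (N : ℕ) (g : JetRing),
        X ((0, 0), 0) ^ N * (f * f') - restrict InHook g ∈ blockMinors := by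
    obtain ⟨N, g, h⟩ := hf
    obtain ⟨N', g', h'⟩ := hf'
    refine ⟨N + N', g * g', ?_⟩
    convert add_mem (Ideal.mul_mem_right (X ((0, 0), 0) ^ N' * f') _ h)
      (Ideal.mul_mem_left _ (restrict InHook g) h') using 1
    rw [map_mul]
    ring
  have hself {v : JetVar} (hv : InHook v) : ∃ (N : ℕ) (g : JetRing),
      X ((0, 0), 0) ^ N * X v - restrict InHook g ∈ blockMinors :=
    ⟨0, X v, by simp [restrict_X, hv]⟩
  induction f using MvPolynomial.induction_on with
  | C a => exact ⟨0, C a, by simp [← algebraMap_eq]⟩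
  | add f f' hf hf' =>
    obtain ⟨N, g, h⟩ := hf
    obtain ⟨N', g', h'⟩ := hf'
    refine ⟨N + N', X ((0, 0), 0) ^ N' * g + X ((0, 0), 0) ^ N * g', ?_⟩
    convert add_mem (Ideal.mul_mem_left _ (X ((0, 0), 0) ^ N') h)
      (Ideal.mul_mem_left _ (X ((0, 0), 0) ^ N) h') using 1
    simp only [map_add, map_mul, map_pow, hX]
    ring
  | mul_X f v hf =>
    rw [map_mul, map_mul]
    refine hmul hf ?_
    obtain ⟨⟨a, b⟩, j⟩ := v
    by_cases hb : b = 2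
    · exact ⟨0, 0, by simp [restrict_X, hb]⟩
    by_cases ha : a = 2
    · exact ⟨0, 0, by simp [restrict_X, ha, hb]⟩
    rw [restrict_X, if_pos hb, restrict_X, if_pos ha]
    by_cases hv : InHook ((a, b), j)
    · exact hself hv
    obtain ⟨rfl, rfl⟩ : a = 1 ∧ b = 1 := by
      fin_cases a <;> fin_cases b <;> simp_all
    have hD : minorZero 0 1 0 1 ∈ blockMinors := Ideal.subset_span (Or.inl rfl)
    have hP : minorOne 0 1 0 1 ∈ blockMinors := Ideal.subset_span (Or.inr rfl)
    by_cases hj : j = 0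
    · subst hj
      refine ⟨1, X ((0, 1), 0) * X ((1, 0), 0), ?_⟩
      convert hD using 1
      simp [restrict_X, InHook, minorZero, entry]
    · obtain rfl : j = 1 := by grind
      refine ⟨2, X ((0, 0), 0) * (X ((0, 1), 0) * X ((1, 0), 1) + X ((0, 1), 1) * X ((1, 0), 0))
        - X ((0, 1), 0) * X ((1, 0), 0) * X ((0, 0), 1), ?_⟩
      convert sub_mem (Ideal.mul_mem_left _ (X ((0, 0), 0)) hP)
        (Ideal.mul_mem_left _ (X ((0, 0), 1)) hD) using 1
      simp [restrict_X, InHook, minorZero, minorOne, entry]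
      ring

lemma restrict_inHook_eq_zero {g : JetRing} (hg : param (restrict InHook g) = 0) :
    restrict InHook g = 0 := by
  suffices X ((0, 0), 0) * restrict InHook g = 0 from
    (mul_eq_zero.1 this).resolve_left (X_ne_zero _)
  refine MvPolynomial.funext fun a => ?_
  rw [map_mul, eval_X, map_zero]
  by_cases h0 : a ((0, 0), 0) = 0
  · rw [h0, zero_mul]
  let c : Fin 2 × Fin 2 × Fin 3 → ℚ := fun t =>
    if t = (0, 0, 0) then 1 else
    if t = (0, 0, 1) then a ((1, 0), 0) / a ((0, 0), 0) else
    if t = (0, 1, 1) then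
      (a ((1, 0), 1) - a ((1, 0), 0) / a ((0, 0), 0) * a ((0, 0), 1)) / a ((0, 0), 0) else
    if t.1 = 1 then a ((0, t.2.2), t.2.1) else 0
  suffices ((aeval c).comp param).comp (restrict InHook) = (aeval a).comp (restrict InHook) by
    have h := DFunLike.congr_fun this g
    simp only [AlgHom.comp_apply, hg, map_zero] at h
    rw [← coe_aeval_eq_eval, RingHom.coe_coe, ← h, mul_zero]
  refine algHom_ext fun v => ?_
  simp only [AlgHom.comp_apply, restrict_X]
  split_ifs with hv
  · obtain ⟨⟨i, k⟩, j⟩ := v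
    by_cases hj : j = 0
    · subst hj
      rw [param_zero]
      rcases hv with hv | hv | hv <;> obtain ⟨rfl, rfl⟩ := Prod.mk.inj hv <;> simp [c, h0]
    · obtain rfl : j = 1 := by grind
      rw [param_one]
      rcases hv with hv | hv | hv <;> obtain ⟨rfl, rfl⟩ := Prod.mk.inj hv <;> simp [c, h0]
  · simp

lemma mem_jetMinors_of_block {f : JetRing} (hrow : restrict (fun v => v.1.1 ≠ 2) f = f)
    (hcol : restrict (fun v => v.1.2 ≠ 2) f = f) (hf : param f = 0) : f ∈ jetMinors := by
  obtain ⟨N, g, h⟩ := exists_pow_mul_sub_mem f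
  rw [hcol, hrow] at h
  have hg : param (restrict InHook g) = 0 := by
    have := jetMinors_le_ker_param (blockMinors_le h)
    simpa [RingHom.mem_ker, hf] using this
  rw [restrict_inHook_eq_zero hg, sub_zero] at h
  exact blockMinors_le (mem_blockMinors_of_pow_mul_mem N h)

/-! ### Transposition -/

/-- Transposition of the jet matrices. -/
noncomputable def transpose : JetRing →ₐ[ℚ] JetRing := rename fun v => (v.1.swap, v.2)

lemma transpose_X (a b : Fin 3) (j : Fin (1 + 1)) :
    transpose (X ((a, b), j)) = X ((b, a), j) := by
  simp [transpose]

lemma transpose_transpose (f : JetRing) : transpose (transpose f) = f := by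
  suffices transpose.comp transpose = AlgHom.id ℚ JetRing from DFunLike.congr_fun this f
  refine algHom_ext fun ⟨⟨a, b⟩, j⟩ => ?_
  simp [transpose_X]

lemma transpose_mem_jetMinors {f : JetRing} (hf : f ∈ jetMinors) : transpose f ∈ jetMinors := by
  suffices jetMinors ≤ jetMinors.comap transpose from this hf
  refine jetMinors_le (fun i k p q => ?_) fun i k p q => ?_
  · rw [Ideal.mem_comap]
    convert minorZero_mem p q i k using 1
    simp only [minorZero, map_sub, map_mul, transpose_X]
    ring
  · rw [Ideal.mem_comap]
    convert minorOne_mem p q i k using 1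
    simp only [minorOne, map_sub, map_add, map_mul, transpose_X]
    ring

lemma restrict_transpose {S S' : JetVar → Prop} [DecidablePred S] [DecidablePred S']
    (hS : ∀ a b j, S ((a, b), j) ↔ S' ((b, a), j)) (f : JetRing) :
    restrict S (transpose f) = transpose (restrict S' f) := by
  suffices (restrict S).comp transpose = transpose.comp (restrict S') from
    DFunLike.congr_fun this f
  refine algHom_ext fun ⟨⟨a, b⟩, j⟩ => ?_
  simp only [AlgHom.comp_apply, transpose_X, restrict_X, hS]
  split_ifs
  · rw [transpose_X]
  · rw [map_zero]

lemma param_transpose (f : JetRing) :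
    param (transpose f) = rename (fun t => (Fin.rev t.1, t.2)) (param f) := by
  suffices param.comp transpose = (rename fun t => (Fin.rev t.1, t.2)).comp param from
    DFunLike.congr_fun this f
  refine algHom_ext fun ⟨⟨a, b⟩, j⟩ => ?_
  by_cases hj : j = 0
  · subst hj
    simp [transpose_X, param_zero, mul_comm]
  · obtain rfl : j = 1 := by grind
    simp [transpose_X, param_one, mul_comm, add_comm]

/-! ### The primary decomposition -/

lemma polarize_mem_zeroOrder (i k : Fin 3) {f : JetRing} (hf : f ∈ zeroOrder) :
    polarize i k f ∈ zeroOrder := by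
  rw [mem_zeroOrder_iff] at hf ⊢
  rw [restrict_polarize (fun _ _ _ _ h => h), hf, map_zero]

lemma weightedHomogeneousComponent_mem_zeroOrder (n : Fin 3 → ℕ) {f : JetRing}
    (hf : f ∈ zeroOrder) : weightedHomogeneousComponent rowWeight n f ∈ zeroOrder := by
  rw [mem_zeroOrder_iff] at hf ⊢
  rw [← restrict_weightedHomogeneousComponent, hf, map_zero]

lemma mem_jetMinors_of_columns {f : JetRing} (hzero : f ∈ zeroOrder) (hf : param f = 0)
    (hcol : restrict (fun v => v.1.2 ≠ 2) f = f) : f ∈ jetMinors := by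
  refine mem_jetMinors_of_rows
    (P := fun f => f ∈ zeroOrder ∧ param f = 0 ∧ restrict (fun v => v.1.2 ≠ 2) f = f)
    (fun f h => h.1) ?_ ?_ ?_ ⟨hzero, hf, hcol⟩
  · rintro i k f ⟨h₁, h₂, h₃⟩
    refine ⟨polarize_mem_zeroOrder i k h₁, ?_, ?_⟩
    · rw [param_polarize, h₂, map_zero]
    · rw [restrict_polarize (fun _ _ _ _ h => h), h₃]
  · rintro n f ⟨h₁, h₂, h₃⟩
    refine ⟨weightedHomogeneousComponent_mem_zeroOrder n h₁, ?_, ?_⟩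
    · rw [← param_weightedHomogeneousComponent, h₂, map_zero]
    · rw [← restrict_weightedHomogeneousComponent, h₃]
  · rintro f ⟨-, h₂, h₃⟩ hv
    exact mem_jetMinors_of_block (restrict_eq_self hv) h₃ h₂

lemma mem_jetMinors {f : JetRing} (hzero : f ∈ zeroOrder) (hf : param f = 0) :
    f ∈ jetMinors := by
  refine mem_jetMinors_of_rows (P := fun f => f ∈ zeroOrder ∧ param f = 0)
    (fun f h => h.1) ?_ ?_ ?_ ⟨hzero, hf⟩
  · rintro i k f ⟨h₁, h₂⟩
    exact ⟨polarize_mem_zeroOrder i k h₁, by rw [param_polarize, h₂, map_zero]⟩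
  · rintro n f ⟨h₁, h₂⟩
    exact ⟨weightedHomogeneousComponent_mem_zeroOrder n h₁,
      by rw [← param_weightedHomogeneousComponent, h₂, map_zero]⟩
  · rintro f ⟨h₁, h₂⟩ hv
    rw [← transpose_transpose f]
    refine transpose_mem_jetMinors (mem_jetMinors_of_columns ?_ ?_ ?_)
    · rw [mem_zeroOrder_iff] at h₁ ⊢
      rw [restrict_transpose (S' := fun v => v.2 = 1) (fun _ _ _ => Iff.rfl), h₁, map_zero]
    · rw [param_transpose, h₂, map_zero]
    · rw [restrict_transpose (S' := fun v => v.1.1 ≠ 2) (fun _ _ _ => Iff.rfl),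
        restrict_eq_self hv]

theorem jetMinors_eq_inf : jetMinors = zeroOrder ⊓ RingHom.ker param :=
  le_antisymm (le_inf jetMinors_le_zeroOrder jetMinors_le_ker_param)
    fun _ hf => mem_jetMinors hf.1 hf.2

lemma zeroOrder_isPrime : zeroOrder.IsPrime := by
  have : zeroOrder = RingHom.ker (restrict fun v => v.2 = 1) :=
    Ideal.ext fun f => mem_zeroOrder_iff
  rw [this]
  exact RingHom.ker_isPrime _

lemma not_zeroOrder_le_ker_param : ¬ zeroOrder ≤ RingHom.ker param := by
  intro h
  have := h (Ideal.subset_span ⟨0, 0, rfl⟩)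
  rw [RingHom.mem_ker, param_zero] at this
  exact mul_ne_zero (X_ne_zero _) (X_ne_zero _) this

lemma not_ker_param_le_zeroOrder : ¬ RingHom.ker param ≤ zeroOrder := by
  intro h
  have hdet : det3 (0, 1) (1, 1) (2, 1) ∈ RingHom.ker param := by
    simp only [RingHom.mem_ker, det3, entry, map_sub, map_add, map_mul, param_one]
    ring
  have := mem_zeroOrder_iff.1 (h hdet)
  replace this := congrArg (eval fun v : JetVar => if v.1.1 = v.1.2 then 1 else 0) this
  simp [det3, entry, restrict_X] at this

lemma minimalPrimes_inf {A : Type*} [CommRing A] {p q : Ideal A} [hp : p.IsPrime]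
    [hq : q.IsPrime] (hpq : ¬ p ≤ q) (hqp : ¬ q ≤ p) : (p ⊓ q).minimalPrimes = {p, q} := by
  ext r
  constructor
  · intro hr
    have := hr.1.1
    rcases this.inf_le.1 hr.1.2 with h | h
    · exact Or.inl (le_antisymm (hr.2 ⟨hp, inf_le_left⟩ h) h)
    · exact Or.inr (le_antisymm (hr.2 ⟨hq, inf_le_right⟩ h) h)
  · rintro (rfl | rfl)
    · refine ⟨⟨hp, inf_le_left⟩, fun s ⟨hs, hle⟩ hsr => ?_⟩
      exact (hs.inf_le.1 hle).resolve_right fun h => hqp (h.trans hsr)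
    · refine ⟨⟨hq, inf_le_right⟩, fun s ⟨hs, hle⟩ hsr => ?_⟩
      exact (hs.inf_le.1 hle).resolve_left fun h => hpq (h.trans hsr)

end JetMinors

/-- for the ideal `I` of `2 × 2` minors of the generic `3 × 3` matrix over
`ℚ`, the ideal of `1`-jets `J_1(I)` is radical, has exactly two minimal primes, and one of
these minimal primes is the ideal generated by the nine order-zero variables. -/
theorem jets_one_of_minors2x2 :
    (jetIdeal ℚ 1 minors2x2).radical = jetIdeal ℚ 1 minors2x2 ∧
    (jetIdeal ℚ 1 minors2x2).minimalPrimes.ncard = 2 ∧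
    Ideal.span {g : MvPolynomial ((Fin 3 × Fin 3) × Fin (1 + 1)) ℚ |
        ∃ a b : Fin 3, g = MvPolynomial.X ((a, b), (0 : Fin (1 + 1)))} ∈
      (jetIdeal ℚ 1 minors2x2).minimalPrimes := by
  have hp := JetMinors.zeroOrder_isPrime
  have hq : (RingHom.ker JetMinors.param).IsPrime := RingHom.ker_isPrime _
  rw [show jetIdeal ℚ 1 minors2x2 = _ from JetMinors.jetMinors_eq_inf, JetMinors.minimalPrimes_inf
    JetMinors.not_zeroOrder_le_ker_param JetMinors.not_ker_param_le_zeroOrder]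
  refine ⟨?_, ?_, Set.mem_insert _ _⟩
  · rw [Ideal.radical_inf, hp.radical, hq.radical]
  · exact Set.ncard_pair fun h => JetMinors.not_zeroOrder_le_ker_param h.le
end
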